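/- Terminating A_n q-binomial theorem of Bhatnagar–Schlosser: Let n be a positive integer, N a nonnegative integer, q a nonzero complex number that is not a root of unity, z a complex number, and x_1, …, x_n nonzero complex numbers such that x_i/x_j is not an integer power of q for i ≠ j. Then ∏_{i=1}^n (z/x_i; q)_N = ∑_{k_1,…,k_n ≥ 0, |k| ≤ N} [ ∏_{1≤i<j≤n} (x_i·q^{k_i} − x_j·q^{k_j})/(x_i − x_j) · ∏_{i,j=1}^n (q·x_i/x_j; q)_{k_i}^{−1} · (q^{−N}; q)_{|k|} · q^{N·|k| + ∑_{1≤i<j≤n} k_i·k_j} · z^{|k|} · ∏_{i=1}^n x_i^{−k_i}·(z/x_i; q)_{|k|−k_i} ], where |k| = k_1 + ⋯ + k_n. -/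

import Mathlib

open Finset

/-- The q-shifted factorial `(a;q)_k`. -/
noncomputable def qPoch (q a : ℂ) (k : ℕ) : ℂ := ∏ i ∈ Finset.range k, (1 - a * q ^ i)

/-- If passing from `F` to `G` multiplies the entries in row and column `r` by `c`, the product
over ordered pairs changes by `∏ s ≠ r, c s`. -/
lemma prod_pairs_lt_mul {ι M : Type*} [Fintype ι] [LinearOrder ι] [CommMonoid M]
    (F G : ι → ι → M) (r : ι) (c : ι → M)
    (h_off : ∀ i j, i ≠ r → j ≠ r → G i j = F i j)
    (h_row : ∀ j, j ≠ r → G r j = F r j * c j)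
    (h_col : ∀ j, j ≠ r → G j r = F j r * c j) :
    (∏ i, ∏ j, if i < j then G i j else 1) =
      (∏ i, ∏ j, if i < j then F i j else 1) * ∏ s ∈ univ.erase r, c s := by
  have key : ∀ i j, (if i < j then G i j else 1) = (if i < j then F i j else 1) *
      ((if i = r then (if r < j then c j else 1) else 1) *
        (if j = r then (if i < r then c i else 1) else 1)) := by
    intro i j
    by_cases hij : i < j
    · by_cases hi : i = r
      · subst hi
        simp [hij, hij.ne', h_row j hij.ne']
      · by_cases hj : j = r
        · subst hj
          simp [hij, hi, h_col i hi]
        · simp [hij, hi, hj, h_off i j hi hj]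
    · by_cases hi : i = r
      · subst hi
        simp [hij]
      · by_cases hj : j = r
        · subst hj
          simp [hij, hi]
        · simp [hij, hi, hj]
  simp_rw [key, prod_mul_distrib]
  congr 1
  rw [prod_comm (s := univ) (t := univ)
    (f := fun i j => if i = r then (if r < j then c j else 1) else 1)]
  simp only [prod_ite_eq', mem_univ, if_true]
  rw [← prod_mul_distrib, ← mul_prod_erase univ _ (mem_univ r)]
  simp only [lt_irrefl, if_false, one_mul]
  refine prod_congr rfl fun s hs => ?_
  rcases lt_or_gt_of_ne (ne_of_mem_erase hs) with h | h
  · simp [h, h.not_gt]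
  · simp [h, h.not_gt]

/-- Lagrange interpolation of a monic polynomial whose degree equals the number of nodes. -/
lemma eval_sub_prod_eq_sum_of_monic {ι K : Type*} [Fintype ι] [DecidableEq ι] [Field K]
    {P : Polynomial K} (hP : P.Monic) (hdeg : P.natDegree = Fintype.card ι)
    {u : ι → K} (hu : Function.Injective u) (v : K) :
    P.eval v - ∏ i, (v - u i) =
      ∑ r, P.eval (u r) * ∏ s ∈ univ.erase r, ((v - u s) / (u r - u s)) := by
  have hnodal : (Lagrange.nodal univ u).Monic := Lagrange.nodal_monic
  have hlt : (P - Lagrange.nodal univ u).degree < #(univ : Finset ι) := by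
    have hPdeg : P.degree = #(univ : Finset ι) := by
      rw [Polynomial.degree_eq_natDegree hP.ne_zero, hdeg, card_univ]
    rw [← hPdeg]
    apply Polynomial.degree_sub_lt_left _ hP.ne_zero
    · rw [hP.leadingCoeff, hnodal.leadingCoeff]
    · rw [hPdeg, Lagrange.degree_nodal]
  have h := congrArg (Polynomial.eval v) (Lagrange.eq_interpolate hu.injOn hlt)
  rw [Polynomial.eval_sub, Lagrange.eval_nodal] at h
  rw [h, Lagrange.interpolate_apply, Polynomial.eval_finsetSum]
  refine sum_congr rfl fun r _ => ?_
  rw [Polynomial.eval_mul, Polynomial.eval_C, Polynomial.eval_sub,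
    Lagrange.eval_nodal_at_node (mem_univ r), sub_zero, Lagrange.basis, Polynomial.eval_prod]
  congr 1
  refine prod_congr rfl fun s _ => ?_
  simp [Lagrange.basisDivisor, div_eq_inv_mul]

/-- The partial fraction expansion of `1 / ∏ i, (1 - w / y i)`, cleared of denominators. -/
lemma one_sub_prod_one_sub_div {ι K : Type*} [Fintype ι] [DecidableEq ι] [Field K]
    {y : ι → K} (hy : Function.Injective y) (hy0 : ∀ i, y i ≠ 0) (w : K) :
    1 - ∏ i, (1 - w / y i) =
      ∑ r, w / y r * ((∏ s ∈ univ.erase r, (y s / (y s - y r))) *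
        ∏ s ∈ univ.erase r, (1 - w / y s)) := by
  rcases eq_or_ne w 0 with rfl | hw
  · simp
  have h := eval_sub_prod_eq_sum_of_monic (P := Polynomial.X ^ Fintype.card ι)
    (Polynomial.monic_X_pow _) (Polynomial.natDegree_X_pow _)
    (u := fun i => (y i)⁻¹) (fun i j hij => hy (inv_injective hij)) w⁻¹
  have h2 := congrArg (fun t => w ^ Fintype.card ι * t) h
  have hsplit : ∀ r : ι, ∀ t : K, t ^ Fintype.card ι = t * ∏ _s ∈ univ.erase r, t := by
    intro r t
    rw [mul_prod_erase univ (fun _ => t) (mem_univ r), prod_const, card_univ]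
  simp only [Polynomial.eval_pow, Polynomial.eval_X, mul_sub, mul_sum] at h2
  rw [← mul_pow, mul_inv_cancel₀ hw, one_pow, ← card_univ, ← prod_const, ← prod_mul_distrib] at h2
  convert h2 using 1
  · congr 1
    refine prod_congr rfl fun i _ => ?_
    field_simp
  · refine sum_congr rfl fun r _ => ?_
    rw [← prod_mul_distrib, card_univ, prod_const, card_univ, hsplit r w, hsplit r (y r)⁻¹]
    have : ∏ s ∈ univ.erase r, (y s / (y s - y r) * (1 - w / y s)) =
        (∏ _s ∈ univ.erase r, w) * ((∏ _s ∈ univ.erase r, (y r)⁻¹) *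
          ∏ s ∈ univ.erase r, ((w⁻¹ - (y s)⁻¹) / ((y r)⁻¹ - (y s)⁻¹))) := by
      rw [← prod_mul_distrib, ← prod_mul_distrib]
      refine prod_congr rfl fun s hs => ?_
      have h1 : y s - y r ≠ 0 := sub_ne_zero.2 (hy.ne (ne_of_mem_erase hs))
      have := hy0 s
      have := hy0 r
      have h3 : (y r)⁻¹ - (y s)⁻¹ = (y s - y r) / (y r * y s) := by field_simp
      rw [h3]
      field_simp
    rw [this]
    ring

/-- Lagrange interpolation at `0` of `∏ j, (1 - t / x j)` with nodes `y r`. -/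
lemma one_sub_prod_div {ι K : Type*} [Fintype ι] [DecidableEq ι] [Field K]
    {x y : ι → K} (hy : Function.Injective y) (hx0 : ∀ i, x i ≠ 0) :
    1 - ∏ i, (y i / x i) =
      ∑ r, (∏ j, (1 - y r / x j)) * ∏ s ∈ univ.erase r, (y s / (y s - y r)) := by
  have h := eval_sub_prod_eq_sum_of_monic (P := ∏ j, (Polynomial.X - Polynomial.C (x j)))
    (Polynomial.monic_prod_of_monic _ _ fun j _ => Polynomial.monic_X_sub_C _)
    (by simp [Polynomial.natDegree_prod_of_monic, Polynomial.monic_X_sub_C]) hy 0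
  simp only [Polynomial.eval_prod, Polynomial.eval_sub, Polynomial.eval_X, Polynomial.eval_C,
    zero_sub] at h
  have h2 := congrArg (fun t => (∏ j, (-x j)⁻¹) * t) h
  simp only [mul_sub, mul_sum, ← mul_assoc, ← prod_mul_distrib] at h2
  convert h2 using 1
  · congr 1
    · exact (prod_eq_one fun j _ => inv_mul_cancel₀ (neg_ne_zero.2 (hx0 j))).symm
    · refine prod_congr rfl fun i _ => ?_
      have := hx0 i
      field_simp
  · refine sum_congr rfl fun r _ => ?_
    congr 1
    · refine prod_congr rfl fun j _ => ?_
      have := hx0 j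
      field_simp
      ring
    · refine prod_congr rfl fun s hs => ?_
      rw [← neg_sub (y r) (y s), div_neg, neg_div]

lemma sum_piAntidiag_add_single {ι M : Type*} [Fintype ι] [DecidableEq ι] [AddCommMonoid M]
    (K : ℕ) (r : ι) (g : (ι → ℕ) → M) (hg : ∀ k, k r = 0 → g k = 0) :
    ∑ l ∈ piAntidiag univ K, g (l + Pi.single r 1) = ∑ k ∈ piAntidiag univ (K + 1), g k := by
  rw [← sum_filter_of_ne (s := piAntidiag univ (K + 1)) (p := fun k => k r ≠ 0)
    fun k _ hk h0 => hk (hg k h0)]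
  refine sum_nbij' (fun l => l + Pi.single r 1) (fun k => k - Pi.single r 1) ?_ ?_ ?_ ?_ ?_
  · intro l hl
    simp only [mem_piAntidiag, mem_filter] at hl ⊢
    refine ⟨⟨?_, by simp⟩, by simp⟩
    simp [sum_add_distrib, hl.1]
  · intro k hk
    simp only [mem_piAntidiag, mem_filter] at hk ⊢
    refine ⟨?_, by simp⟩
    have hle : ∀ i ∈ univ, (Pi.single r 1 : ι → ℕ) i ≤ k i := by
      intro i _
      rcases eq_or_ne i r with rfl | h
      · simpa using Nat.one_le_iff_ne_zero.2 hk.2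
      · simp [h]
    simp [sum_tsub_distrib _ hle, hk.1.1]
  · intro l _
    simp
  · intro k hk
    have hk := (mem_filter.1 hk).2
    ext i
    rcases eq_or_ne i r with rfl | h
    · simpa using Nat.sub_add_cancel (Nat.pos_of_ne_zero hk)
    · simp [h]
  · intro l _
    rfl

lemma qPoch_succ (q a : ℂ) (k : ℕ) : qPoch q a (k + 1) = qPoch q a k * (1 - a * q ^ k) :=
  prod_range_succ _ _

lemma qPoch_succ_left (q a : ℂ) (k : ℕ) : qPoch q a (k + 1) = (1 - a) * qPoch q (q * a) k := by
  rw [qPoch, prod_range_succ', mul_comm, qPoch, pow_zero, mul_one]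
  congr 1
  refine prod_congr rfl fun i _ => ?_
  ring

lemma qPoch_zpow_neg_mul_pow {q : ℂ} (hq : q ≠ 0) (N K : ℕ) :
    qPoch q (q ^ (-(N : ℤ))) K * q ^ (N * K) = ∏ i ∈ range K, (q ^ N - q ^ i) := by
  rw [qPoch, pow_mul, ← card_range K, ← prod_const, card_range, ← prod_mul_distrib]
  refine prod_congr rfl fun i _ => ?_
  rw [zpow_neg, zpow_natCast]
  field_simp

lemma mul_pow_ne_mul_pow {ι : Type*} {q : ℂ} {x : ι → ℂ} (hq : q ≠ 0)
    (hx : ∀ i, x i ≠ 0) (hxq : ∀ i j, i ≠ j → ∀ m : ℤ, x i / x j ≠ q ^ m)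
    {i j : ι} (hij : i ≠ j) (a b : ℕ) :
    x i * q ^ a ≠ x j * q ^ b := by
  intro h
  apply hxq i j hij (b - a)
  rw [zpow_sub₀ hq, zpow_natCast, zpow_natCast, div_eq_div_iff (hx j) (pow_ne_zero _ hq), h]
  ring

lemma injective_mul_pow {ι : Type*} {q : ℂ} {x : ι → ℂ} (hq : q ≠ 0)
    (hx : ∀ i, x i ≠ 0) (hxq : ∀ i j, i ≠ j → ∀ m : ℤ, x i / x j ≠ q ^ m) (k : ι → ℕ) :
    Function.Injective fun i => x i * q ^ k i := by
  intro i j h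
  by_contra hij
  exact mul_pow_ne_mul_pow hq hx hxq hij _ _ h

section LayerSum

variable {ι : Type*} [Fintype ι] [LinearOrder ι]

/-- The factor of the summand of the `A_n` q-binomial theorem that depends on neither `N`
nor `z`. -/
noncomputable def qWeight (q : ℂ) (x : ι → ℂ) (k : ι → ℕ) : ℂ :=
  (∏ i, ∏ j, if i < j then
      (x i * q ^ k i - x j * q ^ k j) / (x i - x j) * q ^ (k i * k j) else 1) *
    (∏ i, ∏ j, (qPoch q (q * x i / x j) (k i))⁻¹) * ∏ i, x i ^ (-(k i : ℤ))

/-- The part of the summation with `|k| = K`, without the factors depending on `K` only. -/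
noncomputable def qLayerSum (q : ℂ) (x : ι → ℂ) (K : ℕ) (z : ℂ) : ℂ :=
  ∑ k ∈ piAntidiag univ K, qWeight q x k * ∏ i, qPoch q (z / x i) (K - k i)

variable {q : ℂ} {x : ι → ℂ}

lemma qWeight_add_single (hq : q ≠ 0) (hqru : ∀ m : ℕ, 0 < m → q ^ m ≠ 1) (hx : ∀ i, x i ≠ 0)
    (hxq : ∀ i j, i ≠ j → ∀ m : ℤ, x i / x j ≠ q ^ m) (l k : ι → ℕ) (r : ι)
    (hk : k = l + Pi.single r 1) :
    qWeight q x l * ((x r)⁻¹ * q ^ ∑ s ∈ univ.erase r, l s) *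
        ∏ s ∈ univ.erase r, (x s * q ^ l s / (x s * q ^ l s - x r * q ^ l r)) =
      qWeight q x k * ((∏ j, (1 - x r * q ^ k r / x j)) *
        ∏ s ∈ univ.erase r, (x s * q ^ k s / (x s * q ^ k s - x r * q ^ k r))) := by
  have hkr : k r = l r + 1 := by simp [hk]
  have hks : ∀ s, s ≠ r → k s = l s := fun s hs => by simp [hk, hs]
  have hne : ∀ {i j : ι}, i ≠ j → ∀ a b : ℕ, x i * q ^ a - x j * q ^ b ≠ 0 :=
    fun hij a b => sub_ne_zero.2 (mul_pow_ne_mul_pow hq hx hxq hij a b)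
  have hpair := prod_pairs_lt_mul
    (fun i j => (x i * q ^ l i - x j * q ^ l j) / (x i - x j) * q ^ (l i * l j))
    (fun i j => (x i * q ^ k i - x j * q ^ k j) / (x i - x j) * q ^ (k i * k j)) r
    (fun s => (x s * q ^ l s - x r * q ^ k r) / (x s * q ^ l s - x r * q ^ l r) * q ^ l s)
    (fun i j hi hj => by simp only [hks i hi, hks j hj])
    (fun j hj => by
      have h1 := hne hj (l j) (l r)
      have h2 : x r * q ^ l r - x j * q ^ l j = -(x j * q ^ l j - x r * q ^ l r) := by ring
      have h3 : x r * q ^ k r - x j * q ^ l j = -(x j * q ^ l j - x r * q ^ k r) := by ring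
      have h4 : q ^ (k r * l j) = q ^ (l r * l j) * q ^ l j := by rw [hkr]; ring
      simp only [hks j hj]
      rw [h2, h3, h4]
      field_simp)
    (fun j hj => by
      have h1 := hne hj (l j) (l r)
      have h4 : q ^ (l j * k r) = q ^ (l j * l r) * q ^ l j := by rw [hkr]; ring
      simp only [hks j hj]
      rw [h4]
      field_simp)
  have hpoch : (∏ i, ∏ j, (qPoch q (q * x i / x j) (k i))⁻¹) =
      (∏ i, ∏ j, (qPoch q (q * x i / x j) (l i))⁻¹) * ∏ j, (1 - x r * q ^ k r / x j)⁻¹ := by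
    rw [← mul_prod_erase univ _ (mem_univ r),
      ← mul_prod_erase univ (fun i => ∏ j, (qPoch q (q * x i / x j) (l i))⁻¹) (mem_univ r),
      mul_right_comm, ← prod_mul_distrib]
    congr 1
    · refine prod_congr rfl fun j _ => ?_
      rw [hkr, qPoch_succ, mul_inv]
      congr 3
      ring
    · refine prod_congr rfl fun s hs => ?_
      rw [hks s (ne_of_mem_erase hs)]
  have hpow : (∏ i, x i ^ (-(k i : ℤ))) = (∏ i, x i ^ (-(l i : ℤ))) * (x r)⁻¹ := by
    rw [← mul_prod_erase univ _ (mem_univ r),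
      ← mul_prod_erase univ (fun i => x i ^ (-(l i : ℤ))) (mem_univ r), mul_right_comm]
    congr 1
    · rw [hkr, ← zpow_neg_one, ← zpow_add₀ (hx r)]
      congr 1
      push_cast
      ring
    · refine prod_congr rfl fun s hs => ?_
      rw [hks s (ne_of_mem_erase hs)]
  have hunit : (∏ j, (1 - x r * q ^ k r / x j)⁻¹) * ∏ j, (1 - x r * q ^ k r / x j) = 1 := by
    rw [← prod_mul_distrib]
    refine prod_eq_one fun j _ => inv_mul_cancel₀ ?_
    rw [one_sub_div (hx j)]
    refine div_ne_zero ?_ (hx j)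
    rcases eq_or_ne j r with rfl | hj
    · rw [hkr, ← mul_one_sub]
      exact mul_ne_zero (hx j) (sub_ne_zero.2 (hqru _ (Nat.succ_pos _)).symm)
    · simpa using hne hj 0 (k r)
  have hprod : (∏ s ∈ univ.erase r,
        ((x s * q ^ l s - x r * q ^ k r) / (x s * q ^ l s - x r * q ^ l r) * q ^ l s)) *
        ∏ s ∈ univ.erase r, (x s * q ^ k s / (x s * q ^ k s - x r * q ^ k r)) =
      q ^ (∑ s ∈ univ.erase r, l s) *
        ∏ s ∈ univ.erase r, (x s * q ^ l s / (x s * q ^ l s - x r * q ^ l r)) := by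
    rw [← prod_pow_eq_pow_sum, ← prod_mul_distrib, ← prod_mul_distrib]
    refine prod_congr rfl fun s hs => ?_
    have hs := ne_of_mem_erase hs
    have h1 := hne hs (l s) (l r)
    have h2 := hne hs (l s) (k r)
    rw [hks s hs]
    field_simp
  simp only [qWeight]
  rw [hpair, hpoch, hpow]
  linear_combination
    -((∏ i, ∏ j, if i < j then
      (x i * q ^ l i - x j * q ^ l j) / (x i - x j) * q ^ (l i * l j) else 1) *
    (∏ i, ∏ j, (qPoch q (q * x i / x j) (l i))⁻¹) * (∏ i, x i ^ (-(l i : ℤ))) * (x r)⁻¹) *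
    (hprod + (∏ s ∈ univ.erase r,
        ((x s * q ^ l s - x r * q ^ k r) / (x s * q ^ l s - x r * q ^ l r) * q ^ l s)) *
        (∏ s ∈ univ.erase r, (x s * q ^ k s / (x s * q ^ k s - x r * q ^ k r))) * hunit)

lemma qLayerSum_zero (hx : Function.Injective x) (z : ℂ) : qLayerSum q x 0 z = 1 := by
  have hpair : (∏ i, ∏ j, if i < j then (x i - x j) / (x i - x j) else 1) = 1 := by
    refine prod_eq_one fun i _ => prod_eq_one fun j _ => ?_
    split_ifs with h
    · exact div_self (sub_ne_zero.2 (hx.ne h.ne))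
    · rfl
  simp [qLayerSum, qWeight, qPoch, hpair]

lemma qLayerSum_succ (hq : q ≠ 0) (hqru : ∀ m : ℕ, 0 < m → q ^ m ≠ 1) (hx : ∀ i, x i ≠ 0)
    (hxq : ∀ i j, i ≠ j → ∀ m : ℤ, x i / x j ≠ q ^ m) (K : ℕ) (z : ℂ) :
    z * (q ^ (K + 1) - 1) * qLayerSum q x (K + 1) z =
      (∏ i, (1 - z / x i)) * qLayerSum q x K (q * z) - qLayerSum q x K z := by
  set g : (ι → ℕ) → ι → ℂ := fun k r => qWeight q x k * ((∏ j, (1 - x r * q ^ k r / x j)) *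
      ∏ s ∈ univ.erase r, (x s * q ^ k s / (x s * q ^ k s - x r * q ^ k r))) *
      ∏ i, qPoch q (z / x i) (K + 1 - k i) with hg
  have hright : ∑ k ∈ piAntidiag univ (K + 1), ∑ r, g k r =
      (1 - q ^ (K + 1)) * qLayerSum q x (K + 1) z := by
    rw [qLayerSum, mul_sum]
    refine sum_congr rfl fun k hk => ?_
    have hsum : ∑ i, k i = K + 1 := (mem_piAntidiag.1 hk).1
    have h := one_sub_prod_div (injective_mul_pow hq hx hxq k) hx
    have hpow : ∏ i, (x i * q ^ k i / x i) = q ^ (K + 1) := by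
      rw [← hsum, ← prod_pow_eq_pow_sum]
      exact prod_congr rfl fun i _ => mul_div_cancel_left₀ _ (hx i)
    rw [hpow] at h
    rw [h, hg, sum_mul]
    refine sum_congr rfl fun r _ => ?_
    ring
  have hleft : ∀ l ∈ piAntidiag (univ : Finset ι) K,
      (∏ i, (1 - z / x i)) * (qWeight q x l * ∏ i, qPoch q (q * z / x i) (K - l i)) -
        qWeight q x l * ∏ i, qPoch q (z / x i) (K - l i) =
      -z * ∑ r, g (l + Pi.single r 1) r := by
    intro l hl
    have hsum : ∑ i, l i = K := (mem_piAntidiag.1 hl).1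
    have hle : ∀ i, l i ≤ K := fun i => hsum ▸ single_le_sum (fun _ _ => Nat.zero_le _) (mem_univ i)
    have hfac : ∀ i, 1 - z * q ^ K / (x i * q ^ l i) = 1 - z / x i * q ^ (K - l i) := by
      intro i
      rw [pow_sub₀ q hq (hle i)]
      have := hx i
      field_simp
    have hshift : (∏ i, (1 - z / x i)) * ∏ i, qPoch q (q * z / x i) (K - l i) =
        (∏ i, qPoch q (z / x i) (K - l i)) * ∏ i, (1 - z * q ^ K / (x i * q ^ l i)) := by
      rw [← prod_mul_distrib, ← prod_mul_distrib]
      refine prod_congr rfl fun i _ => ?_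
      rw [hfac, ← qPoch_succ, qPoch_succ_left, mul_div_assoc]
    have hpf := one_sub_prod_one_sub_div (injective_mul_pow hq hx hxq l)
      (fun i => mul_ne_zero (hx i) (pow_ne_zero _ hq)) (z * q ^ K)
    have hterm : ∀ r, g (l + Pi.single r 1) r * z =
        qWeight q x l * (∏ i, qPoch q (z / x i) (K - l i)) *
        (z * q ^ K / (x r * q ^ l r) *
          ((∏ s ∈ univ.erase r, (x s * q ^ l s / (x s * q ^ l s - x r * q ^ l r))) *
            ∏ s ∈ univ.erase r, (1 - z * q ^ K / (x s * q ^ l s)))) := by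
      intro r
      have hpoch : ∏ i, qPoch q (z / x i) (K + 1 - (l + Pi.single r 1 : ι → ℕ) i) =
          (∏ i, qPoch q (z / x i) (K - l i)) *
            ∏ s ∈ univ.erase r, (1 - z * q ^ K / (x s * q ^ l s)) := by
        rw [← mul_prod_erase univ _ (mem_univ r),
          ← mul_prod_erase univ (fun i => qPoch q (z / x i) (K - l i)) (mem_univ r),
          mul_assoc, ← prod_mul_distrib]
        congr 1
        · simp
        · refine prod_congr rfl fun s hs => ?_
          rw [hfac, ← qPoch_succ, ← Nat.sub_add_comm (hle s)]
          simp [ne_of_mem_erase hs]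
      have hpow : z * q ^ K / (x r * q ^ l r) = z * ((x r)⁻¹ * q ^ ∑ s ∈ univ.erase r, l s) := by
        rw [← hsum, ← add_sum_erase univ l (mem_univ r), pow_add]
        have := hx r
        field_simp
      simp only [hg]
      rw [← qWeight_add_single hq hqru hx hxq l _ r rfl, hpoch, hpow]
      ring
    have hsumterm := sum_congr (rfl : (univ : Finset ι) = univ) fun r _ => hterm r
    rw [← sum_mul, ← mul_sum, ← hpf] at hsumterm
    linear_combination qWeight q x l * hshift + hsumterm
  have hvanish : ∀ (r : ι) (k : ι → ℕ), k r = 0 → g k r = 0 := by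
    intro r k h0
    have : ∏ j, (1 - x r * q ^ k r / x j) = 0 :=
      prod_eq_zero (mem_univ r) (by simp [h0, hx r])
    simp [hg, this]
  have hreindex : ∑ l ∈ piAntidiag univ K, ∑ r, g (l + Pi.single r 1) r =
      ∑ k ∈ piAntidiag univ (K + 1), ∑ r, g k r := by
    rw [sum_comm, sum_comm (s := piAntidiag univ (K + 1))]
    exact sum_congr rfl fun r _ => sum_piAntidiag_add_single K r (g · r) (hvanish r)
  have hdiff := sum_congr rfl hleft
  rw [sum_sub_distrib, ← mul_sum, ← mul_sum, hreindex, hright] at hdiff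
  simp only [qLayerSum] at hdiff ⊢
  rw [hdiff]
  ring

lemma prod_qPoch_eq_sum_qLayerSum (hq : q ≠ 0) (hqru : ∀ m : ℕ, 0 < m → q ^ m ≠ 1)
    (hx : ∀ i, x i ≠ 0) (hxq : ∀ i j, i ≠ j → ∀ m : ℤ, x i / x j ≠ q ^ m) (N : ℕ) (z : ℂ) :
    ∏ i, qPoch q (z / x i) N =
      ∑ K ∈ range (N + 1), z ^ K * qLayerSum q x K z * ∏ i ∈ range K, (q ^ N - q ^ i) := by
  have hinj : Function.Injective x := by simpa using injective_mul_pow hq hx hxq 0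
  induction N generalizing z with
  | zero => simp [qPoch, qLayerSum_zero hinj]
  | succ N ih =>
    have hstep : ∀ K, ∏ i ∈ range (K + 1), (q ^ (N + 1) - q ^ i) =
        q ^ K * (q ^ (K + 1) - 1) * ∏ i ∈ range K, (q ^ N - q ^ i) +
          q ^ (K + 1) * ∏ i ∈ range (K + 1), (q ^ N - q ^ i) := by
      intro K
      have hshift : ∏ i ∈ range K, (q ^ (N + 1) - q ^ (i + 1)) =
          q ^ K * ∏ i ∈ range K, (q ^ N - q ^ i) := by
        conv_rhs => rw [← card_range K, ← prod_const, card_range, ← prod_mul_distrib]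
        exact prod_congr rfl fun i _ => by ring
      rw [prod_range_succ', prod_range_succ, hshift]
      ring
    have hsplit : ∏ i, qPoch q (z / x i) (N + 1) =
        (∏ i, (1 - z / x i)) * ∏ i, qPoch q (q * z / x i) N := by
      rw [← prod_mul_distrib]
      exact prod_congr rfl fun i _ => by rw [qPoch_succ_left, mul_div_assoc]
    have hlast : ∏ i ∈ range (N + 1), (q ^ N - q ^ i) = 0 :=
      prod_eq_zero (self_mem_range_succ N) (sub_self _)
    have htail : ∑ K ∈ range (N + 1), z ^ (K + 1) * qLayerSum q x (K + 1) z *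
          (q ^ (K + 1) * ∏ i ∈ range (K + 1), (q ^ N - q ^ i)) + 1 =
        ∑ K ∈ range (N + 1), z ^ K * qLayerSum q x K z *
          (q ^ K * ∏ i ∈ range K, (q ^ N - q ^ i)) := by
      have h1 := sum_range_succ' (fun K => z ^ K * qLayerSum q x K z *
          (q ^ K * ∏ i ∈ range K, (q ^ N - q ^ i))) (N + 1)
      have h2 := sum_range_succ (fun K => z ^ K * qLayerSum q x K z *
          (q ^ K * ∏ i ∈ range K, (q ^ N - q ^ i))) (N + 1)
      rw [h2, hlast] at h1
      simpa [qLayerSum_zero hinj] using h1.symm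
    rw [hsplit, ih, sum_range_succ' _ (N + 1)]
    simp only [hstep, mul_add, sum_add_distrib, pow_zero, range_zero, prod_empty, mul_one,
      qLayerSum_zero hinj]
    rw [add_assoc, htail, ← sum_add_distrib, mul_sum]
    refine sum_congr rfl fun K _ => ?_
    have h := qLayerSum_succ hq hqru hx hxq K z
    linear_combination (-(z ^ K * q ^ K * ∏ i ∈ range K, (q ^ N - q ^ i))) * h

end LayerSum


/-- Terminating `A_n` q-binomial theorem of Bhatnagar–Schlosser. -/
theorem stmt_11 (n : ℕ) (hn : 0 < n) (N : ℕ) (q : ℂ) (hq : q ≠ 0)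
    (hqru : ∀ m : ℕ, 0 < m → q ^ m ≠ 1) (z : ℂ)
    (x : Fin n → ℂ) (hx : ∀ i, x i ≠ 0)
    (hxq : ∀ i j : Fin n, i ≠ j → ∀ m : ℤ, x i / x j ≠ q ^ m) :
    (∏ i, qPoch q (z / x i) N) =
      ∑ k ∈ Finset.filter (fun k : Fin n → ℕ => ∑ i, k i ≤ N)
          (Fintype.piFinset fun _ => Finset.range (N + 1)),
        ((∏ i, ∏ j, if i < j then (x i * q ^ k i - x j * q ^ k j) / (x i - x j) else 1) *
          (∏ i, ∏ j, (qPoch q (q * x i / x j) (k i))⁻¹) *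
          qPoch q (q ^ (-(N : ℤ))) (∑ i, k i) *
          q ^ (N * (∑ i, k i) + ∑ i, ∑ j, if i < j then k i * k j else 0) *
          z ^ (∑ i, k i) *
          ∏ i, x i ^ (-(k i : ℤ)) * qPoch q (z / x i) ((∑ j, k j) - k i)) := by
  rw [prod_qPoch_eq_sum_qLayerSum hq hqru hx hxq,
    ← sum_fiberwise_of_maps_to (t := range (N + 1)) (g := fun k : Fin n → ℕ => ∑ i, k i)
      fun k hk => mem_range_succ_iff.2 (mem_filter.1 hk).2]
  refine sum_congr rfl fun K hK => ?_
  have hK : K ≤ N := mem_range_succ_iff.1 hK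
  have hfiber : ((Fintype.piFinset fun _ : Fin n => range (N + 1)).filter
      (fun k => ∑ i, k i ≤ N)).filter (fun k => ∑ i, k i = K) = piAntidiag univ K := by
    ext k
    simp only [mem_filter, Fintype.mem_piFinset, mem_range_succ_iff, mem_piAntidiag, mem_univ,
      implies_true, and_true]
    refine ⟨fun h => h.2, fun h => ⟨⟨fun i => ?_, h.trans_le hK⟩, h⟩⟩
    exact (single_le_sum (fun _ _ => Nat.zero_le _) (mem_univ i)).trans (h.trans_le hK)
  rw [hfiber, qLayerSum, mul_sum, sum_mul]
  refine sum_congr rfl fun k hk => ?_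
  have hsum : ∑ i, k i = K := (mem_piAntidiag.1 hk).1
  have hpairs : (∏ i, ∏ j, if i < j then
        (x i * q ^ k i - x j * q ^ k j) / (x i - x j) * q ^ (k i * k j) else 1) =
      (∏ i, ∏ j, if i < j then (x i * q ^ k i - x j * q ^ k j) / (x i - x j) else 1) *
        q ^ ∑ i, ∑ j, if i < j then k i * k j else 0 := by
    simp_rw [← prod_pow_eq_pow_sum, ← prod_mul_distrib]
    refine prod_congr rfl fun i _ => prod_congr rfl fun j _ => ?_
    split_ifs <;> simp
  rw [hsum, qWeight, hpairs, ← qPoch_zpow_neg_mul_pow hq, pow_add, prod_mul_distrib]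
  ring
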